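/- The vector v = (v_X, v_Y, v_Z, v_XY, v_XZ, v_YZ, v_XYZ) = (11, 14, 14, 20, 20, 23, 28) satisfies all three-variable Shannon inequalities (v_XY ≤ v_XYZ and permutations, v_X + v_Y ≥ v_XY and permutations, and v_XZ + v_YZ − v_Z − v_XYZ ≥ 0 and permutations) as well as the seven inequalities −v_X − v_Y − v_Z + v_XY + v_XZ ≥ 0 (and its permutations), −5v_X − 5v_Y − 5v_Z + 4v_XY + 4v_XZ + 4v_YZ − 2v_XYZ ≥ 0, and −3v_X − 3v_Y − 3v_Z + 2v_XY + 2v_XZ + 3v_YZ − v_XYZ ≥ 0 (and its permutations); yet it violates the inequality −2(v_X + v_Y + v_Z) + 3(v_XY + v_XZ + v_YZ) − 4v_XYZ ≥ 0. Consequently there exist no c > 0 and no random variables X, Y, Z compatible with the classical triangle causal structure (i.e., admitting hidden A, B, C with P_{XYZABC} = P_A · P_B · P_C · P_{X|BC} · P_{Y|AC} · P_{Z|AB}) whose entropy vector (H(X), H(Y), H(Z), H(XY), H(XZ), H(YZ), H(XYZ)) equals c · v. -/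

import Mathlib

open Finset
open scoped Classical

/-- Probability that the random variable `X` (on the finite weighted sample space
`(Ω, μ)`) takes the value `b`. -/
noncomputable def pr {Ω β : Type*} [Fintype Ω] (μ : Ω → ℝ) (X : Ω → β) (b : β) : ℝ :=
  ∑ ω, if X ω = b then μ ω else 0

/-- Shannon entropy of the random variable `X` on the finite weighted sample space
`(Ω, μ)`. -/
noncomputable def ent {Ω β : Type*} [Fintype Ω] [Fintype β] (μ : Ω → ℝ) (X : Ω → β) : ℝ :=
  ∑ b, Real.negMulLog (pr μ X b)

/-- Mutual information `I(X : Y)`. -/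
noncomputable def mi {Ω β γ : Type*} [Fintype Ω] [Fintype β] [Fintype γ]
    (μ : Ω → ℝ) (X : Ω → β) (Y : Ω → γ) : ℝ :=
  ent μ X + ent μ Y - ent μ (fun ω => (X ω, Y ω))

/-- Conditional mutual information `I(X : Y | Z)`. -/
noncomputable def cmi {Ω β γ δ : Type*} [Fintype Ω] [Fintype β] [Fintype γ] [Fintype δ]
    (μ : Ω → ℝ) (X : Ω → β) (Y : Ω → γ) (Z : Ω → δ) : ℝ :=
  ent μ (fun ω => (X ω, Z ω)) + ent μ (fun ω => (Y ω, Z ω)) - ent μ Z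
    - ent μ (fun ω => (X ω, Y ω, Z ω))

/-- The Ingleton quantity `I_ING(S,T;U,V)`. -/
noncomputable def ing {Ω β γ δ ε : Type*} [Fintype Ω] [Fintype β] [Fintype γ] [Fintype δ]
    [Fintype ε] (μ : Ω → ℝ) (S : Ω → β) (T : Ω → γ) (U : Ω → δ) (V : Ω → ε) : ℝ :=
  cmi μ S T U + cmi μ S T V + mi μ U V - mi μ S T

/-- A (finite, classical) model of the triangle causal structure `C3`: a finite
probability space `(Ω, μ)`, random variables `X, Y, Z` (observed) and `A, B, C`
(hidden), whose joint distribution factorises as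
`P_{XYZABC} = P_A · P_B · P_C · P_{X|BC} · P_{Y|AC} · P_{Z|AB}`. -/
structure TriangleModel where
  Ω : Type
  [instΩ : Fintype Ω]
  SX : Type
  [instSX : Fintype SX]
  SY : Type
  [instSY : Fintype SY]
  SZ : Type
  [instSZ : Fintype SZ]
  SA : Type
  [instSA : Fintype SA]
  SB : Type
  [instSB : Fintype SB]
  SC : Type
  [instSC : Fintype SC]
  μ : Ω → ℝ
  X : Ω → SX
  Y : Ω → SY
  Z : Ω → SZ
  A : Ω → SA
  B : Ω → SB
  C : Ω → SC
  pA : SA → ℝ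
  pB : SB → ℝ
  pC : SC → ℝ
  qX : SX → SB → SC → ℝ
  qY : SY → SA → SC → ℝ
  qZ : SZ → SA → SB → ℝ
  hμ0 : ∀ ω, 0 ≤ μ ω
  hμ1 : ∑ ω, μ ω = 1
  hpA0 : ∀ a, 0 ≤ pA a
  hpA1 : ∑ a, pA a = 1
  hpB0 : ∀ b, 0 ≤ pB b
  hpB1 : ∑ b, pB b = 1
  hpC0 : ∀ c, 0 ≤ pC c
  hpC1 : ∑ c, pC c = 1
  hqX0 : ∀ x b c, 0 ≤ qX x b c
  hqX1 : ∀ b c, ∑ x, qX x b c = 1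
  hqY0 : ∀ y a c, 0 ≤ qY y a c
  hqY1 : ∀ a c, ∑ y, qY y a c = 1
  hqZ0 : ∀ z a b, 0 ≤ qZ z a b
  hqZ1 : ∀ a b, ∑ z, qZ z a b = 1
  hfact : ∀ x y z a b c,
    pr μ (fun ω => (X ω, Y ω, Z ω, A ω, B ω, C ω)) (x, y, z, a, b, c)
      = pA a * pB b * pC c * qX x b c * qY y a c * qZ z a b

attribute [instance] TriangleModel.instΩ TriangleModel.instSX TriangleModel.instSY
  TriangleModel.instSZ TriangleModel.instSA TriangleModel.instSB TriangleModel.instSC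

/-- The entropy vector `(H(X), H(Y), H(Z), H(XY), H(XZ), H(YZ), H(XYZ))` of the observed
variables of a triangle model. -/
noncomputable def TriangleModel.entVec (M : TriangleModel) : Fin 7 → ℝ :=
  ![ent M.μ M.X, ent M.μ M.Y, ent M.μ M.Z,
    ent M.μ (fun ω => (M.X ω, M.Y ω)),
    ent M.μ (fun ω => (M.X ω, M.Z ω)),
    ent M.μ (fun ω => (M.Y ω, M.Z ω)),
    ent M.μ (fun ω => (M.X ω, M.Y ω, M.Z ω))]

section Entropy

variable {Ω α β γ δ ε : Type*} [Fintype Ω] {μ : Ω → ℝ}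

lemma pr_nonneg (hμ : ∀ ω, 0 ≤ μ ω) (X : Ω → α) (a : α) : 0 ≤ pr μ X a :=
  Finset.sum_nonneg fun ω _ => by split_ifs <;> simp [hμ]

lemma le_pr_self (hμ : ∀ ω, 0 ≤ μ ω) (X : Ω → α) (ω : Ω) : μ ω ≤ pr μ X (X ω) := by
  have h := Finset.single_le_sum (f := fun ω' => if X ω' = X ω then μ ω' else 0)
    (fun i _ => by split_ifs <;> simp [hμ]) (Finset.mem_univ ω)
  simpa [pr] using h

lemma pr_congr {X : Ω → α} {Y : Ω → β} {a : α} {b : β} (h : ∀ ω, X ω = a ↔ Y ω = b) :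
    pr μ X a = pr μ Y b := by
  simp only [pr, h]

/-- The coupling of two copies of `(Ω, μ)` that agree on `R` and are conditionally independent
given `R`. -/
noncomputable def condCopy (μ : Ω → ℝ) (R : Ω → γ) (p : Ω × Ω) : ℝ :=
  if R p.1 = R p.2 then μ p.1 * μ p.2 / pr μ R (R p.1) else 0

lemma condCopy_nonneg (hμ : ∀ ω, 0 ≤ μ ω) (R : Ω → γ) (p : Ω × Ω) : 0 ≤ condCopy μ R p := by
  unfold condCopy
  split_ifs
  · exact div_nonneg (mul_nonneg (hμ _) (hμ _)) (pr_nonneg hμ _ _)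
  · exact le_rfl

lemma pr_condCopy_fst (hμ : ∀ ω, 0 ≤ μ ω) (R : Ω → γ) (P : Ω → α) (a : α) :
    pr (condCopy μ R) (fun p => P p.1) a = pr μ P a := by
  simp only [pr, Fintype.sum_prod_type]
  refine Finset.sum_congr rfl fun ω _ => ?_
  split_ifs with h
  · have hsum : ∑ ω', condCopy μ R (ω, ω') = μ ω * pr μ R (R ω) / pr μ R (R ω) := by
      nth_rewrite 1 [pr]
      rw [Finset.mul_sum, Finset.sum_div]
      refine Finset.sum_congr rfl fun ω' _ => ?_
      by_cases h : R ω = R ω'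
      · simp [condCopy, h]
      · simp [condCopy, h, Ne.symm h]
    rw [hsum]
    rcases (hμ ω).eq_or_lt with h0 | h0
    · simp [← h0]
    · exact mul_div_cancel_right₀ _ (h0.trans_le (le_pr_self hμ R ω)).ne'
  · simp

lemma pr_condCopy (R : Ω → γ) (P : Ω → α) (Q : Ω → β) (a : α) (b : β) (r : γ) :
    pr (condCopy μ R) (fun p => (P p.1, Q p.2, R p.1)) (a, b, r) =
      pr μ (fun ω => (P ω, R ω)) (a, r) *
        (pr μ (fun ω => (Q ω, R ω)) (b, r) / pr μ R r) := by
  rw [pr, Fintype.sum_prod_type, ← mul_div_assoc]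
  nth_rewrite 1 [pr]
  nth_rewrite 1 [pr]
  rw [Finset.sum_mul_sum, Finset.sum_div]
  refine Finset.sum_congr rfl fun ω _ => ?_
  rw [Finset.sum_div]
  refine Finset.sum_congr rfl fun ω' _ => ?_
  simp only [condCopy, Prod.mk.injEq]
  by_cases hr : R ω = r
  · subst hr
    by_cases hr' : R ω' = R ω <;> by_cases ha : P ω = a <;> by_cases hb : Q ω' = b <;>
      simp [hr', ha, hb, eq_comm (a := R ω)]
  · simp [hr]

variable [Fintype α]

/-- Expectation of a function of `X`, computed on the sample space or from the law of `X`. -/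
lemma sum_mul_comp (X : Ω → α) (g : α → ℝ) : ∑ ω, μ ω * g (X ω) = ∑ a, pr μ X a * g a := by
  simp only [pr, Finset.sum_mul]
  rw [Finset.sum_comm]
  simp [ite_mul]

lemma sum_pr_eq (X : Ω → α) : ∑ a, pr μ X a = ∑ ω, μ ω := by
  simpa using (sum_mul_comp (μ := μ) X fun _ => 1).symm

lemma pr_comp (X : Ω → α) (φ : α → β) (b : β) :
    pr μ (fun ω => φ (X ω)) b = ∑ a, pr μ X a * if φ a = b then 1 else 0 := by
  rw [← sum_mul_comp]
  simp [pr]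

lemma sum_pr_prod_right (X : Ω → β) (Y : Ω → α) (b : β) :
    ∑ a, pr μ (fun ω => (X ω, Y ω)) (b, a) = pr μ X b := by
  simp only [pr]
  rw [Finset.sum_comm]
  simp [ite_and, Finset.sum_ite_irrel]

lemma sum_pr_prod_left (X : Ω → α) (Y : Ω → β) (b : β) :
    ∑ a, pr μ (fun ω => (X ω, Y ω)) (a, b) = pr μ Y b := by
  rw [← sum_pr_prod_right Y X b]
  exact Finset.sum_congr rfl fun a _ => pr_congr fun ω => by simp [and_comm]

lemma pr_condCopy_snd (hμ : ∀ ω, 0 ≤ μ ω) (R : Ω → γ) (Q : Ω → α) (t : α × γ) :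
    pr (condCopy μ R) (fun p => (Q p.2, R p.1)) t = pr μ (fun ω => (Q ω, R ω)) t := by
  obtain ⟨b, r⟩ := t
  have h := pr_condCopy (μ := μ) R (fun _ => ()) Q () b r
  rw [pr_congr (Y := fun p : Ω × Ω => (Q p.2, R p.1)) (b := (b, r)) (by simp),
    pr_congr (X := fun ω => ((), R ω)) (Y := R) (b := r) (by simp)] at h
  rw [h]
  rcases eq_or_ne (pr μ R r) 0 with h0 | h0
  · have hle : pr μ (fun ω => (Q ω, R ω)) (b, r) ≤ pr μ R r := by
      rw [← sum_pr_prod_left Q R r]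
      exact Finset.single_le_sum (f := fun b => pr μ (fun ω => (Q ω, R ω)) (b, r))
        (fun _ _ => pr_nonneg hμ _ _) (Finset.mem_univ b)
    have := pr_nonneg hμ (fun ω => (Q ω, R ω)) (b, r)
    rw [h0, zero_mul]
    linarith
  · exact mul_div_cancel₀ _ h0

variable [Fintype β] [Fintype γ] [Fintype δ] [Fintype ε]

/-- Entropy as an expectation over the sample space. -/
lemma ent_eq_sum (X : Ω → α) : ent μ X = -∑ ω, μ ω * Real.log (pr μ X (X ω)) := by
  rw [sum_mul_comp X fun a => Real.log (pr μ X a)]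
  simp [ent, Real.negMulLog]

/-- Entropy only depends on the partition of the sample space induced by the variable. -/
lemma ent_congr {X : Ω → α} {Y : Ω → β} (h : ∀ ω ω', X ω = X ω' ↔ Y ω = Y ω') :
    ent μ X = ent μ Y := by
  rw [ent_eq_sum, ent_eq_sum]
  congr 1
  refine Finset.sum_congr rfl fun ω _ => ?_
  rw [pr_congr (Y := Y) (b := Y ω) fun ω' => h ω' ω]

/-- Variables with the same law have images with the same entropy. -/
lemma ent_comp_eq_of_pr_eq {Ω' : Type*} [Fintype Ω'] {ν : Ω' → ℝ} {X : Ω → α} {X' : Ω' → α}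
    (h : ∀ a, pr ν X' a = pr μ X a) (φ : α → β) :
    ent ν (fun ω => φ (X' ω)) = ent μ (fun ω => φ (X ω)) := by
  simp only [ent, pr_comp, h]

lemma cmi_comp_eq_of_pr_eq {Ω' : Type*} [Fintype Ω'] {ν : Ω' → ℝ} {X : Ω → α} {X' : Ω' → α}
    (h : ∀ a, pr ν X' a = pr μ X a) (φ : α → β) (ψ : α → γ) (χ : α → δ) :
    cmi ν (fun ω => φ (X' ω)) (fun ω => ψ (X' ω)) (fun ω => χ (X' ω)) =
      cmi μ (fun ω => φ (X ω)) (fun ω => ψ (X ω)) (fun ω => χ (X ω)) := by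
  rw [cmi, cmi, ent_comp_eq_of_pr_eq h χ, ent_comp_eq_of_pr_eq h fun a => (φ a, χ a),
    ent_comp_eq_of_pr_eq h fun a => (ψ a, χ a),
    ent_comp_eq_of_pr_eq h fun a => (φ a, ψ a, χ a)]

lemma ing_comp_eq_of_pr_eq {Ω' : Type*} [Fintype Ω'] {ν : Ω' → ℝ} {X : Ω → α} {X' : Ω' → α}
    (h : ∀ a, pr ν X' a = pr μ X a) (φ : α → β) (ψ : α → γ) (χ : α → δ) (θ : α → ε) :
    ing ν (fun ω => φ (X' ω)) (fun ω => ψ (X' ω)) (fun ω => χ (X' ω)) (fun ω => θ (X' ω)) =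
      ing μ (fun ω => φ (X ω)) (fun ω => ψ (X ω)) (fun ω => χ (X ω)) (fun ω => θ (X ω)) := by
  rw [ing, ing, cmi_comp_eq_of_pr_eq h, cmi_comp_eq_of_pr_eq h, mi, mi, mi, mi,
    ent_comp_eq_of_pr_eq h φ, ent_comp_eq_of_pr_eq h ψ, ent_comp_eq_of_pr_eq h χ,
    ent_comp_eq_of_pr_eq h θ, ent_comp_eq_of_pr_eq h fun a => (φ a, ψ a),
    ent_comp_eq_of_pr_eq h fun a => (χ a, θ a)]

/-- Submodularity of Shannon entropy. -/
lemma cmi_nonneg (hμ : ∀ ω, 0 ≤ μ ω) (X : Ω → α) (Y : Ω → β) (Z : Ω → γ) :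
    0 ≤ cmi μ X Y Z := by
  let G : α × β × γ → ℝ := fun t =>
    pr μ (fun ω => (X ω, Z ω)) (t.1, t.2.2) * pr μ (fun ω => (Y ω, Z ω)) t.2 /
      (pr μ (fun ω => (X ω, Y ω, Z ω)) t * pr μ Z t.2.2)
  have hG : ∑ ω, μ ω * G (X ω, Y ω, Z ω) ≤ ∑ ω, μ ω := by
    rw [sum_mul_comp (fun ω => (X ω, Y ω, Z ω)) G]
    calc ∑ t, pr μ (fun ω => (X ω, Y ω, Z ω)) t * G t
        ≤ ∑ t : α × β × γ, pr μ (fun ω => (X ω, Z ω)) (t.1, t.2.2) *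
            pr μ (fun ω => (Y ω, Z ω)) t.2 / pr μ Z t.2.2 := by
          refine Finset.sum_le_sum fun t _ => ?_
          rcases eq_or_ne (pr μ (fun ω => (X ω, Y ω, Z ω)) t) 0 with h | h
          · rw [h, zero_mul]
            exact div_nonneg (mul_nonneg (pr_nonneg hμ _ _) (pr_nonneg hμ _ _))
              (pr_nonneg hμ _ _)
          · refine le_of_eq ?_
            simp only [G]
            rw [← mul_div_assoc, mul_div_mul_left _ _ h]
      _ = ∑ z, pr μ Z z * pr μ Z z / pr μ Z z := by
          simp only [Fintype.sum_prod_type]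
          rw [Finset.sum_congr rfl fun x _ => Finset.sum_comm, Finset.sum_comm]
          refine Finset.sum_congr rfl fun z _ => ?_
          simp only [← Finset.sum_div, ← Finset.sum_mul_sum, sum_pr_prod_left]
      _ = ∑ ω, μ ω := by
          simp [mul_self_div_self, sum_pr_eq]
  have key : ∑ ω, (μ ω - μ ω * G (X ω, Y ω, Z ω)) ≤ cmi μ X Y Z := by
    simp only [cmi, ent_eq_sum, sub_eq_add_neg, neg_neg, ← Finset.sum_neg_distrib,
      ← Finset.sum_add_distrib]
    refine Finset.sum_le_sum fun ω _ => ?_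
    rcases (hμ ω).eq_or_lt with h | h
    · simp [← h]
    have h1 := h.trans_le (le_pr_self hμ (fun ω => (X ω, Z ω)) ω)
    have h2 := h.trans_le (le_pr_self hμ (fun ω => (Y ω, Z ω)) ω)
    have h3 := h.trans_le (le_pr_self hμ (fun ω => (X ω, Y ω, Z ω)) ω)
    have h4 := h.trans_le (le_pr_self hμ Z ω)
    have hlog := Real.log_le_sub_one_of_pos (div_pos (mul_pos h1 h2) (mul_pos h3 h4))
    rw [Real.log_div (mul_pos h1 h2).ne' (mul_pos h3 h4).ne', Real.log_mul h1.ne' h2.ne',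
      Real.log_mul h3.ne' h4.ne'] at hlog
    have := mul_le_mul_of_nonneg_left hlog h.le
    simp only [G]
    linarith
  rw [Finset.sum_sub_distrib] at key
  linarith

/-- A factorising joint law gives vanishing conditional mutual information. -/
lemma cmi_eq_zero (hμ : ∀ ω, 0 ≤ μ ω) {X : Ω → α} {Y : Ω → β} {Z : Ω → γ}
    (f : α → γ → ℝ) (g : β → γ → ℝ)
    (h : ∀ x y z, pr μ (fun ω => (X ω, Y ω, Z ω)) (x, y, z) = f x z * g y z) :
    cmi μ X Y Z = 0 := by
  have hXZ : ∀ x z, pr μ (fun ω => (X ω, Z ω)) (x, z) = f x z * ∑ y, g y z := by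
    intro x z
    rw [← sum_pr_prod_left Y (fun ω => (X ω, Z ω)), Finset.mul_sum]
    refine Finset.sum_congr rfl fun y _ => ?_
    rw [← h]
    exact pr_congr fun ω => by simp only [Prod.mk.injEq]; tauto
  have hYZ : ∀ y z, pr μ (fun ω => (Y ω, Z ω)) (y, z) = (∑ x, f x z) * g y z := by
    intro y z
    rw [← sum_pr_prod_left X (fun ω => (Y ω, Z ω)), Finset.sum_mul]
    exact Finset.sum_congr rfl fun x _ => h x y z
  have hZ : ∀ z, pr μ Z z = (∑ x, f x z) * ∑ y, g y z := by
    intro z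
    rw [← sum_pr_prod_left X Z, Finset.sum_mul]
    exact Finset.sum_congr rfl fun x _ => hXZ x z
  simp only [cmi, ent_eq_sum, sub_eq_add_neg, neg_neg, ← Finset.sum_neg_distrib,
    ← Finset.sum_add_distrib]
  refine Finset.sum_eq_zero fun ω _ => ?_
  rcases (hμ ω).eq_or_lt with h0 | h0
  · simp [← h0]
  have h1 := (h0.trans_le (le_pr_self hμ (fun ω => (X ω, Z ω)) ω)).ne'
  have h2 := (h0.trans_le (le_pr_self hμ (fun ω => (Y ω, Z ω)) ω)).ne'
  simp only [hXZ, hYZ, ne_eq, mul_eq_zero, not_or] at h1 h2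
  rw [h, hXZ, hYZ, hZ, Real.log_mul h1.1 h1.2, Real.log_mul h2.1 h2.2,
    Real.log_mul h1.1 h2.2, Real.log_mul h2.1 h1.2]
  ring

/-- The five-variable Shannon inequality underlying the Zhang–Yeung inequality. -/
lemma ing_add_nonneg_of_cmi_eq_zero (hμ : ∀ ω, 0 ≤ μ ω)
    (S : Ω → α) (T : Ω → β) (U : Ω → γ) (V : Ω → δ) (W : Ω → ε)
    (hW : cmi μ (fun ω => (U ω, V ω)) W (fun ω => (S ω, T ω)) = 0) :
    0 ≤ ing μ S T U V + cmi μ S T W + cmi μ S W T + cmi μ T W S := by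
  have h1 := cmi_nonneg hμ U V W
  have h2 := cmi_nonneg hμ S T (fun ω => (U ω, W ω))
  have h3 := cmi_nonneg hμ S T (fun ω => (V ω, W ω))
  have h4 := cmi_nonneg hμ W U S
  have h5 := cmi_nonneg hμ W U T
  have h6 := cmi_nonneg hμ W V S
  have h7 := cmi_nonneg hμ W V T
  have h8 := cmi_nonneg hμ W V (fun ω => (S ω, T ω, U ω))
  have h9 := cmi_nonneg hμ W U (fun ω => (S ω, T ω, V ω))
  have h10 := cmi_nonneg hμ W (fun ω => (S ω, T ω)) (fun ω => (U ω, V ω))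
  have eWS : ent μ (fun ω => (W ω, S ω)) = ent μ (fun ω => (S ω, W ω)) :=
    ent_congr fun _ _ => by simp only [Prod.mk.injEq]; tauto
  have eUS : ent μ (fun ω => (U ω, S ω)) = ent μ (fun ω => (S ω, U ω)) :=
    ent_congr fun _ _ => by simp only [Prod.mk.injEq]; tauto
  have eWUS : ent μ (fun ω => (W ω, U ω, S ω)) = ent μ (fun ω => (S ω, U ω, W ω)) :=
    ent_congr fun _ _ => by simp only [Prod.mk.injEq]; tauto
  have eWT : ent μ (fun ω => (W ω, T ω)) = ent μ (fun ω => (T ω, W ω)) :=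
    ent_congr fun _ _ => by simp only [Prod.mk.injEq]; tauto
  have eUT : ent μ (fun ω => (U ω, T ω)) = ent μ (fun ω => (T ω, U ω)) :=
    ent_congr fun _ _ => by simp only [Prod.mk.injEq]; tauto
  have eWUT : ent μ (fun ω => (W ω, U ω, T ω)) = ent μ (fun ω => (T ω, U ω, W ω)) :=
    ent_congr fun _ _ => by simp only [Prod.mk.injEq]; tauto
  have eVS : ent μ (fun ω => (V ω, S ω)) = ent μ (fun ω => (S ω, V ω)) :=
    ent_congr fun _ _ => by simp only [Prod.mk.injEq]; tauto
  have eWVS : ent μ (fun ω => (W ω, V ω, S ω)) = ent μ (fun ω => (S ω, V ω, W ω)) :=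
    ent_congr fun _ _ => by simp only [Prod.mk.injEq]; tauto
  have eVT : ent μ (fun ω => (V ω, T ω)) = ent μ (fun ω => (T ω, V ω)) :=
    ent_congr fun _ _ => by simp only [Prod.mk.injEq]; tauto
  have eWVT : ent μ (fun ω => (W ω, V ω, T ω)) = ent μ (fun ω => (T ω, V ω, W ω)) :=
    ent_congr fun _ _ => by simp only [Prod.mk.injEq]; tauto
  have eWSTU : ent μ (fun ω => (W ω, S ω, T ω, U ω)) = ent μ (fun ω => (S ω, T ω, U ω, W ω)) :=
    ent_congr fun _ _ => by simp only [Prod.mk.injEq]; tauto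
  have eVSTU : ent μ (fun ω => (V ω, S ω, T ω, U ω)) = ent μ (fun ω => (S ω, T ω, U ω, V ω)) :=
    ent_congr fun _ _ => by simp only [Prod.mk.injEq]; tauto
  have eWVSTU : ent μ (fun ω => (W ω, V ω, S ω, T ω, U ω)) =
      ent μ (fun ω => (S ω, T ω, U ω, V ω, W ω)) :=
    ent_congr fun _ _ => by simp only [Prod.mk.injEq]; tauto
  have eWSTV : ent μ (fun ω => (W ω, S ω, T ω, V ω)) = ent μ (fun ω => (S ω, T ω, V ω, W ω)) :=
    ent_congr fun _ _ => by simp only [Prod.mk.injEq]; tauto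
  have eUSTV : ent μ (fun ω => (U ω, S ω, T ω, V ω)) = ent μ (fun ω => (S ω, T ω, U ω, V ω)) :=
    ent_congr fun _ _ => by simp only [Prod.mk.injEq]; tauto
  have eWUSTV : ent μ (fun ω => (W ω, U ω, S ω, T ω, V ω)) =
      ent μ (fun ω => (S ω, T ω, U ω, V ω, W ω)) :=
    ent_congr fun _ _ => by simp only [Prod.mk.injEq]; tauto
  have eWUV : ent μ (fun ω => (W ω, U ω, V ω)) = ent μ (fun ω => (U ω, V ω, W ω)) :=
    ent_congr fun _ _ => by simp only [Prod.mk.injEq]; tauto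
  have eSTUV : ent μ (fun ω => ((S ω, T ω), U ω, V ω)) = ent μ (fun ω => (S ω, T ω, U ω, V ω)) :=
    ent_congr fun _ _ => by simp only [Prod.mk.injEq]; tauto
  have eWSTUV : ent μ (fun ω => (W ω, (S ω, T ω), U ω, V ω)) =
      ent μ (fun ω => (S ω, T ω, U ω, V ω, W ω)) :=
    ent_congr fun _ _ => by simp only [Prod.mk.injEq]; tauto
  have eUVST : ent μ (fun ω => ((U ω, V ω), S ω, T ω)) = ent μ (fun ω => (S ω, T ω, U ω, V ω)) :=
    ent_congr fun _ _ => by simp only [Prod.mk.injEq]; tauto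
  have eWST : ent μ (fun ω => (W ω, S ω, T ω)) = ent μ (fun ω => (S ω, T ω, W ω)) :=
    ent_congr fun _ _ => by simp only [Prod.mk.injEq]; tauto
  have eUVWST : ent μ (fun ω => ((U ω, V ω), W ω, S ω, T ω)) =
      ent μ (fun ω => (S ω, T ω, U ω, V ω, W ω)) :=
    ent_congr fun _ _ => by simp only [Prod.mk.injEq]; tauto
  have eSWT : ent μ (fun ω => (S ω, W ω, T ω)) = ent μ (fun ω => (S ω, T ω, W ω)) :=
    ent_congr fun _ _ => by simp only [Prod.mk.injEq]; tauto
  have eTS : ent μ (fun ω => (T ω, S ω)) = ent μ (fun ω => (S ω, T ω)) :=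
    ent_congr fun _ _ => by simp only [Prod.mk.injEq]; tauto
  have eTWS : ent μ (fun ω => (T ω, W ω, S ω)) = ent μ (fun ω => (S ω, T ω, W ω)) :=
    ent_congr fun _ _ => by simp only [Prod.mk.injEq]; tauto
  simp only [ing, cmi, mi, eWS, eUS, eWUS, eWT, eUT, eWUT, eVS, eWVS, eVT, eWVT, eWSTU,
    eVSTU, eWVSTU, eWSTV, eUSTV, eWUSTV, eWUV, eSTUV, eWSTUV, eUVST, eWST, eUVWST, eSWT,
    eTS, eTWS] at *
  linarith

/-- The Zhang–Yeung inequality. -/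
theorem zhang_yeung (hμ : ∀ ω, 0 ≤ μ ω) (S : Ω → α) (T : Ω → β) (U : Ω → γ) (V : Ω → δ) :
    0 ≤ ing μ S T U V + cmi μ S T U + cmi μ S U T + cmi μ T U S := by
  let R : Ω → α × β := fun ω => (S ω, T ω)
  have h := ing_add_nonneg_of_cmi_eq_zero (condCopy_nonneg hμ R)
    (fun p => S p.1) (fun p => T p.1) (fun p => U p.1) (fun p => V p.1) (fun p => U p.2)
    (cmi_eq_zero (condCopy_nonneg hμ R) _ _
      (pr_condCopy (μ := μ) R (fun ω => (U ω, V ω)) U))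
  rwa [ing_comp_eq_of_pr_eq (X := fun ω => ω) (pr_condCopy_fst hμ R fun ω => ω),
    cmi_comp_eq_of_pr_eq (pr_condCopy_snd hμ R U) (fun t => t.2.1) (fun t => t.2.2)
      (fun t => t.1),
    cmi_comp_eq_of_pr_eq (pr_condCopy_snd hμ R U) (fun t => t.2.1) (fun t => t.1)
      (fun t => t.2.2),
    cmi_comp_eq_of_pr_eq (pr_condCopy_snd hμ R U) (fun t => t.2.2) (fun t => t.1)
      (fun t => t.2.1)] at h

end Entropy

namespace TriangleModel

variable (M : TriangleModel)

lemma cmi_XY_C : cmi M.μ M.X M.Y M.C = 0 := by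
  refine cmi_eq_zero M.hμ0 (fun x c => M.pC c * ∑ b, M.pB b * M.qX x b c)
    (fun y c => ∑ a, M.pA a * M.qY y a c) fun x y c => ?_
  have h : pr M.μ (fun ω => (M.X ω, M.Y ω, M.C ω)) (x, y, c) =
      ∑ b, ∑ a, ∑ z, M.pA a * M.pB b * M.pC c * M.qX x b c * M.qY y a c * M.qZ z a b := by
    simp only [← M.hfact]
    rw [← sum_pr_prod_right _ M.B]
    refine Finset.sum_congr rfl fun b _ => ?_
    rw [← sum_pr_prod_right _ M.A]
    refine Finset.sum_congr rfl fun a _ => ?_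
    rw [← sum_pr_prod_right _ M.Z]
    exact Finset.sum_congr rfl fun z _ =>
      pr_congr fun ω => by simp only [Prod.mk.injEq]; tauto
  rw [h, mul_assoc, Finset.sum_mul_sum, Finset.mul_sum]
  refine Finset.sum_congr rfl fun b _ => ?_
  rw [Finset.mul_sum]
  refine Finset.sum_congr rfl fun a _ => ?_
  rw [← Finset.mul_sum, M.hqZ1]
  ring

lemma mi_Z_C : mi M.μ M.Z M.C = 0 := by
  have hcmi : cmi M.μ M.Z M.C (fun _ => ()) = 0 := by
    refine cmi_eq_zero M.hμ0 (fun z _ => ∑ a, ∑ b, M.pA a * M.pB b * M.qZ z a b)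
      (fun c _ => M.pC c) fun z c _ => ?_
    have h : pr M.μ (fun ω => (M.Z ω, M.C ω, ())) (z, c, ()) =
        ∑ a, ∑ b, ∑ x, ∑ y,
          M.pA a * M.pB b * M.pC c * M.qX x b c * M.qY y a c * M.qZ z a b := by
      simp only [← M.hfact]
      rw [← sum_pr_prod_right _ M.A]
      refine Finset.sum_congr rfl fun a _ => ?_
      rw [← sum_pr_prod_right _ M.B]
      refine Finset.sum_congr rfl fun b _ => ?_
      rw [← sum_pr_prod_right _ M.X]
      refine Finset.sum_congr rfl fun x _ => ?_
      rw [← sum_pr_prod_right _ M.Y]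
      exact Finset.sum_congr rfl fun y _ =>
        pr_congr fun ω => by simp only [Prod.mk.injEq]; tauto
    rw [h, Finset.sum_mul]
    refine Finset.sum_congr rfl fun a _ => ?_
    rw [Finset.sum_mul]
    refine Finset.sum_congr rfl fun b _ => ?_
    simp only [← Finset.sum_mul, ← Finset.mul_sum, M.hqY1, M.hqX1]
    ring
  have h0 : ent M.μ (fun _ => ()) = 0 := by simp [ent, pr, M.hμ1]
  have h1 : ent M.μ (fun ω => (M.Z ω, ())) = ent M.μ M.Z := ent_congr (by simp)
  have h2 : ent M.μ (fun ω => (M.C ω, ())) = ent M.μ M.C := ent_congr (by simp)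
  have h3 : ent M.μ (fun ω => (M.Z ω, M.C ω, ())) = ent M.μ (fun ω => (M.Z ω, M.C ω)) :=
    ent_congr (by simp)
  simp only [cmi, h0, h1, h2, h3] at hcmi
  simp only [mi]
  linarith

/-- The Zhang–Yeung inequality restricted to the observed variables of the triangle. -/
theorem entVec_ineq : 0 ≤ -2 * (M.entVec 0 + M.entVec 1 + M.entVec 2)
    + 3 * (M.entVec 3 + M.entVec 4 + M.entVec 5) - 4 * M.entVec 6 := by
  have h := zhang_yeung M.hμ0 M.X M.Y M.Z M.C
  rw [ing, cmi_XY_C, mi_Z_C] at h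
  have h1 : ent M.μ (fun ω => (M.Y ω, M.X ω)) = ent M.μ (fun ω => (M.X ω, M.Y ω)) :=
    ent_congr fun _ _ => by simp only [Prod.mk.injEq]; tauto
  have h2 : ent M.μ (fun ω => (M.Z ω, M.X ω)) = ent M.μ (fun ω => (M.X ω, M.Z ω)) :=
    ent_congr fun _ _ => by simp only [Prod.mk.injEq]; tauto
  have h3 : ent M.μ (fun ω => (M.Z ω, M.Y ω)) = ent M.μ (fun ω => (M.Y ω, M.Z ω)) :=
    ent_congr fun _ _ => by simp only [Prod.mk.injEq]; tauto
  have h4 : ent M.μ (fun ω => (M.X ω, M.Z ω, M.Y ω)) =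
      ent M.μ (fun ω => (M.X ω, M.Y ω, M.Z ω)) :=
    ent_congr fun _ _ => by simp only [Prod.mk.injEq]; tauto
  have h5 : ent M.μ (fun ω => (M.Y ω, M.Z ω, M.X ω)) =
      ent M.μ (fun ω => (M.X ω, M.Y ω, M.Z ω)) :=
    ent_congr fun _ _ => by simp only [Prod.mk.injEq]; tauto
  simp only [cmi, mi, h1, h2, h3, h4, h5] at h
  simp only [entVec, Matrix.cons_val]
  linarith

end TriangleModel

/-- **The Shannon outer approximation of the triangle is not tight.**  The vector
`v = (11, 14, 14, 20, 20, 23, 28)` (coordinates ordered as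
`(v_X, v_Y, v_Z, v_XY, v_XZ, v_YZ, v_XYZ)`) satisfies all three-variable Shannon
inequalities and the seven inequalities defining the Shannon outer approximation
`Γ_M(C3)`, yet violates `−2(v_X+v_Y+v_Z) + 3(v_XY+v_XZ+v_YZ) − 4v_XYZ ≥ 0`;
consequently no positive multiple of `v` is the entropy vector of the observed variables
of any distribution compatible with the classical triangle causal structure. -/
theorem shannon_approx_not_tight :
    let v : Fin 7 → ℝ := ![11, 14, 14, 20, 20, 23, 28]
    -- monotonicity
    (v 3 ≤ v 6 ∧ v 4 ≤ v 6 ∧ v 5 ≤ v 6) ∧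
    -- nonnegativity of the pairwise mutual informations
    (v 3 ≤ v 0 + v 1 ∧ v 4 ≤ v 0 + v 2 ∧ v 5 ≤ v 1 + v 2) ∧
    -- submodularity (nonnegativity of the conditional mutual informations)
    (0 ≤ v 4 + v 5 - v 2 - v 6 ∧ 0 ≤ v 3 + v 5 - v 1 - v 6 ∧ 0 ≤ v 3 + v 4 - v 0 - v 6) ∧
    -- first class of triangle inequalities and its permutations
    (0 ≤ -v 0 - v 1 - v 2 + v 3 + v 4 ∧
     0 ≤ -v 0 - v 1 - v 2 + v 3 + v 5 ∧
     0 ≤ -v 0 - v 1 - v 2 + v 4 + v 5) ∧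
    -- second class of triangle inequalities (symmetric)
    (0 ≤ -5 * v 0 - 5 * v 1 - 5 * v 2 + 4 * v 3 + 4 * v 4 + 4 * v 5 - 2 * v 6) ∧
    -- third class of triangle inequalities and its permutations
    (0 ≤ -3 * v 0 - 3 * v 1 - 3 * v 2 + 2 * v 3 + 2 * v 4 + 3 * v 5 - v 6 ∧
     0 ≤ -3 * v 0 - 3 * v 1 - 3 * v 2 + 2 * v 3 + 3 * v 4 + 2 * v 5 - v 6 ∧
     0 ≤ -3 * v 0 - 3 * v 1 - 3 * v 2 + 3 * v 3 + 2 * v 4 + 2 * v 5 - v 6) ∧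
    -- violation of the non-Shannon-derived inequality
    ¬ (0 ≤ -2 * (v 0 + v 1 + v 2) + 3 * (v 3 + v 4 + v 5) - 4 * v 6) ∧
    -- hence no positive multiple of `v` is realisable in the triangle causal structure
    ¬ ∃ (c : ℝ) (M : TriangleModel), 0 < c ∧ M.entVec = fun i => c * v i := by
  intro v
  refine ⟨?_, ?_, ?_, ?_, ?_, ?_, ?_, ?_⟩
  rotate_right
  · rintro ⟨c, M, hc, hM⟩
    have h := M.entVec_ineq
    simp only [hM, v, Matrix.cons_val] at h
    linarith
  all_goals
    simp only [v, Matrix.cons_val]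
    norm_num
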